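/- arXiv:1603.00754 — 2 statements merged into one kernel-verified Lean document; each statement's English description precedes it below -/
import Mathlib

section
/- Let A be a finite nonempty alphabet, l ≥ 1, and C ⊆ A^{Q_l} with Q_l = {0,…,l−1}². For a strip u, there exists a configuration x ∈ X_C with R_0(x) = u if and only if there exists a complementary family B₀ of admissible strips with u ∈ B₀. -/
namespace SFT2

variable {A : Type*}

/-- The square `Q_l = {0,…,l−1}²` as a subset of `ℤ²`. -/
def Q (l : ℕ) : Set (ℤ × ℤ) :=
  {s | (0 ≤ s.1 ∧ s.1 < (l : ℤ)) ∧ (0 ≤ s.2 ∧ s.2 < (l : ℤ))}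

/-- A pattern `p : Q l → A` occurs in a function `x : T → A`:
there is `b ∈ ℤ²` with `b + Q l ⊆ T` such that `x (b + s) = p s` on `Q l`. -/
def OccursIn (l : ℕ) (p : Q l → A) (T : Set (ℤ × ℤ)) (x : T → A) : Prop :=
  ∃ b : ℤ × ℤ, ∃ h : ∀ s ∈ Q l, b + s ∈ T,
    ∀ s : Q l, x ⟨b + s.1, h s.1 s.2⟩ = p s

/-- A pattern `p : Q l → A` occurs in a full configuration `x : ℤ² → A`. -/
def OccursCfg (l : ℕ) (p : Q l → A) (x : ℤ × ℤ → A) : Prop :=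
  ∃ b : ℤ × ℤ, ∀ s : Q l, x (b + s.1) = p s

/-- The subshift of finite type determined by the forbidden set `C ⊆ A^{Q_l}`. -/
def XC (l : ℕ) (C : Set (Q l → A)) : Set (ℤ × ℤ → A) :=
  {x | ∀ p ∈ C, ¬ OccursCfg l p x}

/-- The domain `ℤ × {0,…,l−1}` of strips. -/
def StripDom (l : ℕ) : Set (ℤ × ℤ) := {s | 0 ≤ s.2 ∧ s.2 < (l : ℤ)}

/-- The domain `ℤ × {0,…,2l−1}` of stacks of two strips. -/
def StackDom (l : ℕ) : Set (ℤ × ℤ) := {s | 0 ≤ s.2 ∧ s.2 < 2 * (l : ℤ)}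

/-- The stack of two strips: `u` on rows `0,…,l−1` and `v` on rows `l,…,2l−1`. -/
def stack (l : ℕ) (u v : StripDom l → A) : StackDom l → A :=
  fun s =>
    if h : s.1.2 < (l : ℤ) then u ⟨s.1, ⟨s.2.1, h⟩⟩
    else v ⟨(s.1.1, s.1.2 - l), ⟨by have := s.2.1; omega, by have := s.2.2; omega⟩⟩

/-- A strip `u` is admissible if no pattern of `C` occurs in it. -/
def AdmissibleStrip (l : ℕ) (C : Set (Q l → A)) (u : StripDom l → A) : Prop :=
  ∀ p ∈ C, ¬ OccursIn l p (StripDom l) u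

/-- `(u,v)` is an admissible pair if no pattern of `C` occurs in `stack u v`. -/
def AdmissiblePair (l : ℕ) (C : Set (Q l → A)) (u v : StripDom l → A) : Prop :=
  ∀ p ∈ C, ¬ OccursIn l p (StackDom l) (stack l u v)

/-- The `n`-th strip of a configuration: `R_n(x)(i,j) = x(i, n·l + j)`. -/
def R (l : ℕ) (x : ℤ × ℤ → A) (n : ℤ) : StripDom l → A :=
  fun s => x (s.1.1, n * l + s.1.2)

/-- A family `B` of admissible strips is complementary if every `u ∈ B` has
`v, w ∈ B` with `(u,v)` and `(w,u)` admissible pairs. -/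
def Complementary (l : ℕ) (C : Set (Q l → A)) (B : Set (StripDom l → A)) : Prop :=
  (∀ u ∈ B, AdmissibleStrip l C u) ∧
    ∀ u ∈ B, (∃ v ∈ B, AdmissiblePair l C u v) ∧ ∃ w ∈ B, AdmissiblePair l C w u

end SFT2

namespace SFT2

variable {A : Type*}

lemma stack_R (l : ℕ) (x : ℤ × ℤ → A) (n : ℤ) (s : StackDom l) :
    stack l (R l x n) (R l x (n + 1)) s = x (s.1.1, n * l + s.1.2) := by
  unfold stack R
  split_ifs
  · rfl
  · congr 2
    ring

lemma admissibleStrip_R {l : ℕ} {C : Set (Q l → A)} {x : ℤ × ℤ → A} (hx : x ∈ XC l C) (n : ℤ) :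
    AdmissibleStrip l C (R l x n) := by
  rintro p hp ⟨b, h, hb⟩
  refine hx p hp ⟨(b.1, n * l + b.2), fun s => ?_⟩
  rw [← hb s]
  change x _ = x _
  congr 1
  ext <;> simp [add_assoc]

lemma mem_XC_iff_forall_admissiblePair {l : ℕ} (hl : 1 ≤ l) {C : Set (Q l → A)}
    {x : ℤ × ℤ → A} :
    x ∈ XC l C ↔ ∀ n : ℤ, AdmissiblePair l C (R l x n) (R l x (n + 1)) := by
  have hl' : (0 : ℤ) < l := by exact_mod_cast hl
  constructor
  · rintro hx n p hp ⟨b, h, hb⟩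
    refine hx p hp ⟨(b.1, n * l + b.2), fun s => ?_⟩
    rw [← hb s, stack_R]
    congr 1
    ext <;> simp [add_assoc]
  · rintro hx p hp ⟨b, hb⟩
    refine hx (b.2 / l) p hp ⟨(b.1, b.2 % l), ?_, fun s => ?_⟩
    · rintro s ⟨-, h0, h1⟩
      have := Int.emod_nonneg b.2 hl'.ne'
      have := Int.emod_lt_of_pos b.2 hl'
      constructor <;> simp only [Prod.snd_add] <;> linarith
    · rw [stack_R, ← hb s]
      congr 1
      have := Int.ediv_mul_add_emod b.2 l
      ext
      · rfl
      · simp only [Prod.snd_add]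
        linarith

/-- A relation that is serial in both directions admits a bi-infinite chain through each point. -/
lemma exists_int_chain {α : Type*} {r : α → α → Prop} (hr : ∀ a, ∃ b, r a b)
    (hr' : ∀ a, ∃ b, r b a) (a : α) :
    ∃ f : ℤ → α, f 0 = a ∧ ∀ n, r (f n) (f (n + 1)) := by
  choose F hF using hr
  choose G hG using hr'
  refine ⟨fun n => Int.rec (fun k => F^[k] a) (fun k => G^[k + 1] a) n, rfl, fun n => ?_⟩
  rcases n with k | _ | k
  · change r (F^[k] a) (F^[k + 1] a)
    rw [Function.iterate_succ_apply']
    exact hF _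
  · exact hG a
  · change r (G^[k + 2] a) (G^[k + 1] a)
    rw [Function.iterate_succ_apply' G (k + 1)]
    exact hG _

lemma exists_R_eq {l : ℕ} (hl : 1 ≤ l) (f : ℤ → StripDom l → A) :
    ∃ x : ℤ × ℤ → A, ∀ n, R l x n = f n := by
  have hl' : (0 : ℤ) < l := by exact_mod_cast hl
  refine ⟨fun s => f (s.2 / l) ⟨(s.1, s.2 % l), Int.emod_nonneg _ hl'.ne',
    Int.emod_lt_of_pos _ hl'⟩, fun n => ?_⟩
  funext ⟨⟨i, j⟩, h0, h1⟩
  have hd : (n * l + j) / (l : ℤ) = n := by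
    rw [add_comm, Int.add_mul_ediv_right _ _ hl'.ne', Int.ediv_eq_zero_of_lt h0 h1, zero_add]
  have hm : (n * l + j) % (l : ℤ) = j := by
    rw [add_comm, Int.add_mul_emod_self_right, Int.emod_eq_of_lt h0 h1]
  simp only [R, hd, hm]

end SFT2

/-- a strip `u` extends to a configuration `x ∈ X_C` with `R_0(x) = u`
iff `u` belongs to some complementary family of admissible strips. -/
theorem stmt5 {A : Type*} [Finite A] [Nonempty A] (l : ℕ) (hl : 1 ≤ l)
    (C : Set (SFT2.Q l → A)) (u : SFT2.StripDom l → A) :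
    (∃ x ∈ SFT2.XC l C, SFT2.R l x 0 = u) ↔
      ∃ B : Set (SFT2.StripDom l → A), SFT2.Complementary l C B ∧ u ∈ B := by
  constructor
  · rintro ⟨x, hx, rfl⟩
    have hpair := (SFT2.mem_XC_iff_forall_admissiblePair hl).1 hx
    refine ⟨Set.range (SFT2.R l x), ⟨?_, ?_⟩, 0, rfl⟩
    · rintro _ ⟨n, rfl⟩
      exact SFT2.admissibleStrip_R hx n
    · rintro _ ⟨n, rfl⟩
      refine ⟨⟨_, ⟨n + 1, rfl⟩, hpair n⟩, _, ⟨n - 1, rfl⟩, ?_⟩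
      simpa using hpair (n - 1)
  · rintro ⟨B, ⟨-, hB⟩, hu⟩
    obtain ⟨f, hf0, hf⟩ := SFT2.exists_int_chain
      (r := fun v w : B => SFT2.AdmissiblePair l C v w)
      (fun v => by simpa using (hB v v.2).1) (fun v => by simpa using (hB v v.2).2) ⟨u, hu⟩
    obtain ⟨x, hx⟩ := SFT2.exists_R_eq hl fun n => (f n : SFT2.StripDom l → A)
    refine ⟨x, (SFT2.mem_XC_iff_forall_admissiblePair hl).2 fun n => ?_, ?_⟩
    · rw [hx, hx]
      exact hf n
    · rw [hx, hf0]
end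

section
/- Let A be a finite nonempty alphabet, l ≥ 1, and C ⊆ A^{Q_l} with Q_l = {0,…,l−1}². If there exists a finite nonempty complementary family B₀ of admissible strips, then X_C contains a vertically periodic point: there exist x ∈ X_C and an integer k ≥ 1 such that x(i, j + k) = x(i, j) for all (i,j) ∈ ℤ². -/
/-- A self-map of a finite nonempty type has a periodic point. -/
theorem Function.exists_isPeriodicPt_of_finite {α : Type*} [Finite α] [Nonempty α] (f : α → α) :
    ∃ a, ∃ n : ℕ, 0 < n ∧ Function.IsPeriodicPt f n a := by
  obtain ⟨u⟩ := ‹Nonempty α›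
  obtain ⟨m, n, hmn, h⟩ := Finite.exists_ne_map_eq_of_infinite fun k : ℕ => f^[k] u
  wlog hlt : m < n generalizing m n
  · exact this n m hmn.symm h.symm (by omega)
  refine ⟨f^[m] u, n - m, by omega, ?_⟩
  change f^[n - m] (f^[m] u) = f^[m] u
  rw [← Function.iterate_add_apply, Nat.sub_add_cancel hlt.le]
  exact h.symm

/-- A self-map of a finite nonempty type has a periodic two-sided orbit. -/
theorem Function.exists_periodic_int_orbit {α : Type*} [Finite α] [Nonempty α] (f : α → α) :
    ∃ w : ℤ → α, (∀ q, w (q + 1) = f (w q)) ∧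
      ∃ n : ℤ, 1 ≤ n ∧ ∀ q, w (q + n) = w q := by
  obtain ⟨a, n, hn, ha⟩ := Function.exists_isPeriodicPt_of_finite f
  refine ⟨fun q => f^[(q % n).toNat] a, fun q => ?_, n, by omega, fun q => by simp⟩
  have h0 := Int.emod_nonneg q (b := n) (by omega)
  have h1 : ((q + 1) % n).toNat = ((q % n).toNat + 1) % n := by
    zify
    rw [Int.toNat_of_nonneg (Int.emod_nonneg _ (by omega)), Int.toNat_of_nonneg h0,
      Int.emod_add_emod]
  change f^[((q + 1) % n).toNat] a = _
  rw [h1, ha.iterate_mod_apply, Function.iterate_succ_apply']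

namespace SFT2

variable {A : Type*}

/-- The configuration whose `n`-th strip is `w n`. -/
def glue (l : ℕ) (hl : 1 ≤ l) (w : ℤ → StripDom l → A) (s : ℤ × ℤ) : A :=
  w (s.2 / l) ⟨(s.1, s.2 % l), Int.emod_nonneg _ (by omega), Int.emod_lt_of_pos _ (by omega)⟩

theorem glue_eq {l : ℕ} (hl : 1 ≤ l) (w : ℤ → StripDom l → A) (i q : ℤ) {r : ℤ}
    (hr : (i, r) ∈ StripDom l) : glue l hl w (i, r + l * q) = w q ⟨(i, r), hr⟩ := by
  have hq : (r + l * q) / (l : ℤ) = q := by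
    rw [Int.add_mul_ediv_left _ _ (by omega), Int.ediv_eq_zero_of_lt hr.1 hr.2, zero_add]
  have hm : (r + l * q) % (l : ℤ) = r := by
    rw [Int.add_mul_emod_self_left, Int.emod_eq_of_lt hr.1 hr.2]
  simp only [glue, hq, hm]

theorem glue_eq_stack {l : ℕ} (hl : 1 ≤ l) (w : ℤ → StripDom l → A) (i q : ℤ) {r : ℤ}
    (hr : (i, r) ∈ StackDom l) :
    glue l hl w (i, r + l * q) = stack l (w q) (w (q + 1)) ⟨(i, r), hr⟩ := by
  obtain ⟨h0, h1⟩ := hr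
  dsimp only at h0 h1
  by_cases h : r < l
  · rw [glue_eq hl w i q ⟨h0, h⟩]
    simp [stack, h]
  · rw [show r + l * q = (r - l) + l * (q + 1) by ring,
      glue_eq hl w i (q + 1) ⟨by dsimp only; omega, by dsimp only; omega⟩]
    simp [stack, h]

theorem glue_mem_XC {l : ℕ} (hl : 1 ≤ l) {C : Set (Q l → A)} {w : ℤ → StripDom l → A}
    (hw : ∀ q, AdmissiblePair l C (w q) (w (q + 1))) : glue l hl w ∈ XC l C := by
  rintro p hp ⟨⟨b₁, b₂⟩, hb⟩
  have h0 := Int.emod_nonneg b₂ (b := l) (by omega)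
  have h1 := Int.emod_lt_of_pos b₂ (b := l) (by omega)
  refine hw (b₂ / l) p hp ⟨(b₁, b₂ % l), ?_, ?_⟩
  · rintro ⟨s₁, s₂⟩ ⟨-, h2, h3⟩
    dsimp only at h2 h3
    constructor <;> simp only [Prod.mk_add_mk] <;> omega
  · rintro ⟨⟨s₁, s₂⟩, hs⟩
    rw [← hb ⟨(s₁, s₂), hs⟩]
    have hdiv := Int.emod_add_mul_ediv b₂ l
    simp only [Prod.mk_add_mk]
    rw [← glue_eq_stack hl w]
    congr 2
    linarith

theorem glue_add_mul {l : ℕ} (hl : 1 ≤ l) {w : ℤ → StripDom l → A} {n : ℤ}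
    (hw : ∀ q, w (q + n) = w q) (i j : ℤ) :
    glue l hl w (i, j + l * n) = glue l hl w (i, j) := by
  simp only [glue, Int.add_mul_emod_self_left,
    Int.add_mul_ediv_left j n (show (l : ℤ) ≠ 0 by omega), hw]

end SFT2

/-- if there is a finite nonempty complementary family of admissible
strips, then `X_C` contains a vertically periodic point. -/
theorem stmt7 {A : Type*} [Finite A] [Nonempty A] (l : ℕ) (hl : 1 ≤ l)
    (C : Set (SFT2.Q l → A)) (B : Set (SFT2.StripDom l → A))
    (hfin : B.Finite) (hne : B.Nonempty) (hcomp : SFT2.Complementary l C B) :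
    ∃ x ∈ SFT2.XC l C, ∃ k : ℤ, 1 ≤ k ∧ ∀ i j : ℤ, x (i, j + k) = x (i, j) := by
  have := hfin.to_subtype
  have := hne.to_subtype
  choose f hfB hf using fun u : B => (hcomp.2 u u.2).1
  obtain ⟨w, hw, n, hn, hper⟩ :=
    Function.exists_periodic_int_orbit fun u : B => (⟨f u, hfB u⟩ : B)
  refine ⟨SFT2.glue l hl fun q => (w q).1, SFT2.glue_mem_XC hl fun q => ?_, l * n, ?_,
    SFT2.glue_add_mul hl fun q => by rw [hper]⟩
  · rw [hw]
    exact hf (w q)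
  · exact one_le_mul_of_one_le_of_one_le (by omega) hn
end
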